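/- Let 0 ⊂ I_1 ⊊ J_1 ⊂ S and 0 ⊂ I_2 ⊊ J_2 ⊂ S be monomial ideals. Suppose there exists a function Φ : Mon(S) → Mon(S) such that: (i) for every monomial u, u ∈ I_1 if and only if Φ(u) ∈ I_2; (ii) for every monomial u, u ∈ J_1 if and only if Φ(u) ∈ J_2; (iii) for every Stanley space uK[Z] ⊂ S and every monomial v, v ∈ uK[Z] if and only if Φ(v) ∈ Φ(u)K[Z]. Then slength(J_1/I_1) ≤ slength(J_2/I_2). -/

import Mathlib

open MvPolynomial

/-- The set of exponent vectors of the monomials in the Stanley space `x^u · K[Z]`. -/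
def stanleySet {σ : Type} (u : σ →₀ ℕ) (Z : Set σ) : Set (σ →₀ ℕ) :=
  {w | ∃ v : σ →₀ ℕ, ↑v.support ⊆ Z ∧ w = u + v}

/-- A Stanley decomposition (partition into Stanley spaces) of a set `P` of
exponent vectors of monomials.  By the standard correspondence, Stanley
decompositions of a multigraded `K`-vector subquotient of `S` spanned by the
monomials with exponents in `P` correspond exactly to such partitions. -/
structure StanleyPartition {σ : Type} (P : Set (σ →₀ ℕ)) where
  r : ℕ
  base : Fin r → σ →₀ ℕ
  vars : Fin r → Set σ
  cover : P = ⋃ i, stanleySet (base i) (vars i)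
  disj : ∀ i j, i ≠ j → Disjoint (stanleySet (base i) (vars i)) (stanleySet (base j) (vars j))

/-- The Stanley length of `P`: the minimal length of a Stanley decomposition. -/
noncomputable def slength {σ : Type} (P : Set (σ →₀ ℕ)) : ℕ :=
  sInf {r | ∃ D : StanleyPartition P, D.r = r}

/-- The set of exponent vectors of the monomials belonging to an ideal. -/
def monSet {σ K : Type} [Field K] (I : Ideal (MvPolynomial σ K)) : Set (σ →₀ ℕ) :=
  {d | (monomial d (1 : K) : MvPolynomial σ K) ∈ I}

/-- `I` is a monomial ideal. -/
def IsMonomialIdeal {σ K : Type} [Field K] (I : Ideal (MvPolynomial σ K)) : Prop :=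
  ∃ A : Set (σ →₀ ℕ), I = Ideal.span ((fun d => (monomial d (1 : K) : MvPolynomial σ K)) '' A)

/-- Exponent vectors of the minimal monomial generators of `I`. -/
def minGens {σ K : Type} [Field K] (I : Ideal (MvPolynomial σ K)) : Set (σ →₀ ℕ) :=
  {d | d ∈ monSet I ∧ ∀ e ∈ monSet I, e ≤ d → e = d}

theorem mem_stanleySet_iff {σ : Type} {u w : σ →₀ ℕ} {Z : Set σ} :
    w ∈ stanleySet u Z ↔ ∀ i, u i ≤ w i ∧ (i ∉ Z → w i = u i) := by
  constructor
  · rintro ⟨v, hv, rfl⟩ i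
    refine ⟨by simp, fun hi => ?_⟩
    have : v i = 0 := by
      by_contra h
      exact hi (hv (by simpa using h))
    simp [this]
  · intro h
    refine ⟨w - u, fun i hi => ?_, ?_⟩
    · by_contra hZ
      have := (h i).2 hZ
      simp [this] at hi
    · ext i
      have := (h i).1
      simp only [Finsupp.add_apply, Finsupp.tsub_apply]
      omega

/-- A partition into Stanley spaces indexed by a finite type gives a Stanley partition. -/
theorem exists_stanleyPartition_of_finite {σ ι : Type} [Finite ι] {P : Set (σ →₀ ℕ)}
    (base : ι → σ →₀ ℕ) (vars : ι → Set σ)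
    (cover : P = ⋃ i, stanleySet (base i) (vars i))
    (disj : ∀ i j, i ≠ j → Disjoint (stanleySet (base i) (vars i)) (stanleySet (base j) (vars j))) :
    ∃ D : StanleyPartition P, D.r = Nat.card ι := by
  let e := (Finite.equivFin ι).symm
  refine ⟨⟨Nat.card ι, base ∘ e, vars ∘ e, ?_, fun i j hij => disj _ _ (e.injective.ne hij)⟩, rfl⟩
  rw [cover]
  exact (e.surjective.iUnion_comp fun i => stanleySet (base i) (vars i)).symm

theorem isUpperSet_monSet {σ K : Type} [Field K] (I : Ideal (MvPolynomial σ K)) :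
    IsUpperSet (monSet I) := by
  intro a b hab ha
  have h : (monomial b (1 : K) : MvPolynomial σ K) = monomial (b - a) 1 * monomial a 1 := by
    rw [monomial_mul, one_mul, tsub_add_cancel_of_le hab]
  change (monomial b (1 : K) : MvPolynomial σ K) ∈ I
  rw [h]
  exact I.mul_mem_left _ ha

/-- Membership in an upper set of exponent vectors is detected after truncating all exponents at a
sufficiently large bound. -/
theorem IsUpperSet.exists_forall_inf_mem_iff {σ : Type} [Finite σ] {U : Set (σ →₀ ℕ)}
    (hU : IsUpperSet U) :
    ∃ B : σ →₀ ℕ, ∀ C, B ≤ C → ∀ d, d ⊓ C ∈ U ↔ d ∈ U := by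
  have hfin : {d | Minimal (· ∈ U) d}.Finite :=
    WellQuasiOrderedLE.finite_of_isAntichain (setOfPred_minimal_antichain (· ∈ U))
  obtain ⟨B, hB⟩ := hfin.bddAbove
  refine ⟨B, fun C hC d => ⟨fun h => hU inf_le_left h, fun h => ?_⟩⟩
  obtain ⟨m, hmd, hm⟩ := exists_minimal_le_of_wellFoundedLT (· ∈ U) d h
  exact hU (le_inf hmd ((hB hm).trans hC)) hm.prop

/-- The difference of two upper sets of exponent vectors has a Stanley partition. -/
theorem IsUpperSet.nonempty_stanleyPartition_diff {σ : Type} [Finite σ] {U V : Set (σ →₀ ℕ)}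
    (hU : IsUpperSet U) (hV : IsUpperSet V) : Nonempty (StanleyPartition (U \ V)) := by
  obtain ⟨B, hB⟩ := hU.exists_forall_inf_mem_iff
  obtain ⟨B', hB'⟩ := hV.exists_forall_inf_mem_iff
  have hU' := hB (B ⊔ B') le_sup_left
  have hV' := hB' (B ⊔ B') le_sup_right
  set C := B ⊔ B'
  have key : ∀ c ≤ C, ∀ d, d ∈ stanleySet c {i | c i = C i} ↔ d ⊓ C = c := by
    intro c hc d
    rw [mem_stanleySet_iff, Finsupp.ext_iff]
    refine forall_congr' fun i => ?_
    have := hc i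
    simp only [Set.mem_ofPred_eq, Finsupp.inf_apply]
    omega
  let ι := {c : σ →₀ ℕ // c ∈ Set.Iic C ∩ (U \ V)}
  have : Finite ι := by
    classical
    exact ((Set.finite_Icc 0 C).subset fun c hc => ⟨zero_le, hc.1⟩).to_subtype
  have cover : U \ V = ⋃ c : ι, stanleySet c.1 {i | c.1 i = C i} := by
    ext d
    rw [Set.mem_iUnion]
    constructor
    · intro hd
      exact ⟨⟨d ⊓ C, Set.mem_Iic.2 inf_le_right, (hU' d).2 hd.1, fun h => hd.2 ((hV' d).1 h)⟩,
        (key _ inf_le_right d).2 rfl⟩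
    · rintro ⟨⟨c, hc, hcU, hcV⟩, hd⟩
      obtain rfl := (key c hc d).1 hd
      exact ⟨(hU' d).1 hcU, fun h => hcV ((hV' d).2 h)⟩
  have disj : ∀ a b : ι, a ≠ b →
      Disjoint (stanleySet a.1 {i | a.1 i = C i}) (stanleySet b.1 {i | b.1 i = C i}) := by
    intro a b hab
    rw [Set.disjoint_left]
    intro d hda hdb
    exact hab (Subtype.ext (((key _ a.2.1 d).1 hda).symm.trans ((key _ b.2.1 d).1 hdb)))
  obtain ⟨D, -⟩ := exists_stanleyPartition_of_finite _ _ cover disj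
  exact ⟨D⟩

/-- A map compatible with Stanley spaces acts coordinatewise. -/
theorem apply_eq_of_stanleySet {σ : Type} {Φ : (σ →₀ ℕ) → (σ →₀ ℕ)}
    (hΦ : ∀ (u : σ →₀ ℕ) (Z : Set σ) (v : σ →₀ ℕ), v ∈ stanleySet u Z ↔ Φ v ∈ stanleySet (Φ u) Z)
    {u v : σ →₀ ℕ} {j : σ} (h : u j = v j) : Φ u j = Φ v j := by
  have key : ∀ w, (u ⊓ v) j = w j → u ⊓ v ≤ w → Φ w j = Φ (u ⊓ v) j := by
    intro w hj hw
    have hmem : w ∈ stanleySet (u ⊓ v) {j}ᶜ := mem_stanleySet_iff.2 fun i => ⟨hw i, fun hi => by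
      obtain rfl : i = j := by simpa using hi
      exact hj.symm⟩
    exact (mem_stanleySet_iff.1 ((hΦ _ _ _).1 hmem) j).2 (by simp)
  rw [key u (by simp [h]) inf_le_left, key v (by simp [h]) inf_le_right]

/-- A map compatible with Stanley spaces is monotone in every coordinate. -/
theorem apply_le_of_stanleySet {σ : Type} {Φ : (σ →₀ ℕ) → (σ →₀ ℕ)}
    (hΦ : ∀ (u : σ →₀ ℕ) (Z : Set σ) (v : σ →₀ ℕ), v ∈ stanleySet u Z ↔ Φ v ∈ stanleySet (Φ u) Z)
    {u v : σ →₀ ℕ} {j : σ} (h : u j ≤ v j) : Φ u j ≤ Φ v j := by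
  have hj : (u ⊓ v) j = u j := by simp [h]
  rw [← apply_eq_of_stanleySet hΦ hj]
  have hmem : v ∈ stanleySet (u ⊓ v) Set.univ :=
    mem_stanleySet_iff.2 fun i => ⟨by simp, fun hi => absurd trivial hi⟩
  exact (mem_stanleySet_iff.1 ((hΦ _ _ _).1 hmem) j).1

/-- A map compatible with Stanley spaces is injective in every coordinate. -/
theorem eq_of_apply_eq_of_stanleySet {σ : Type} {Φ : (σ →₀ ℕ) → (σ →₀ ℕ)}
    (hΦ : ∀ (u : σ →₀ ℕ) (Z : Set σ) (v : σ →₀ ℕ), v ∈ stanleySet u Z ↔ Φ v ∈ stanleySet (Φ u) Z)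
    {u v : σ →₀ ℕ} {j : σ} (h : Φ u j = Φ v j) : u j = v j := by
  wlog hle : u j ≤ v j generalizing u v
  · exact (this h.symm (le_of_not_ge hle)).symm
  have hu := apply_eq_of_stanleySet hΦ (u := Finsupp.single j (u j)) (v := u) (j := j) (by simp)
  have hv := apply_eq_of_stanleySet hΦ (u := Finsupp.single j (v j)) (v := v) (j := j) (by simp)
  have hmem : Finsupp.single j (v j) ∈ stanleySet (Finsupp.single j (u j)) ∅ := by
    refine (hΦ _ _ _).2 (mem_stanleySet_iff.2 fun i => ?_)
    have hi : Φ (Finsupp.single j (v j)) i = Φ (Finsupp.single j (u j)) i := by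
      by_cases hij : i = j
      · subst hij
        rw [hu, hv, h]
      · exact apply_eq_of_stanleySet hΦ (by simp [Ne.symm hij])
    exact ⟨hi.ge, fun _ => hi⟩
  simpa using ((mem_stanleySet_iff.1 hmem j).2 (by simp)).symm

/-- A nonempty preimage of a Stanley space under a map compatible with Stanley spaces is a
Stanley space. -/
theorem exists_preimage_stanleySet_eq {σ : Type} [Finite σ] {Φ : (σ →₀ ℕ) → (σ →₀ ℕ)}
    (hΦ : ∀ (u : σ →₀ ℕ) (Z : Set σ) (v : σ →₀ ℕ), v ∈ stanleySet u Z ↔ Φ v ∈ stanleySet (Φ u) Z)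
    {b : σ →₀ ℕ} {Z : Set σ}
    (hne : (Φ ⁻¹' stanleySet b Z).Nonempty) :
    ∃ c, Φ ⁻¹' stanleySet b Z = stanleySet c Z := by
  obtain ⟨v, hv⟩ := hne
  obtain ⟨c, -, hc⟩ := exists_minimal_le_of_wellFoundedLT (· ∈ Φ ⁻¹' stanleySet b Z) v hv
  have hcb := mem_stanleySet_iff.1 hc.prop
  refine ⟨c, Set.ext fun w => ?_⟩
  rw [Set.mem_preimage, mem_stanleySet_iff, mem_stanleySet_iff]
  constructor
  · intro hw
    have hmem : w ⊓ c ∈ Φ ⁻¹' stanleySet b Z := by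
      refine mem_stanleySet_iff.2 fun i => ?_
      rcases le_total (w i) (c i) with h | h
      · rw [apply_eq_of_stanleySet hΦ (u := w ⊓ c) (v := w) (j := i) (by simp [h])]
        exact hw i
      · rw [apply_eq_of_stanleySet hΦ (u := w ⊓ c) (v := c) (j := i) (by simp [h])]
        exact hcb i
    have hle : c ≤ w := (hc.le_of_le hmem inf_le_right).trans inf_le_left
    exact fun i => ⟨hle i, fun hi =>
      eq_of_apply_eq_of_stanleySet hΦ (((hw i).2 hi).trans ((hcb i).2 hi).symm)⟩
  · exact fun h i => ⟨(hcb i).1.trans (apply_le_of_stanleySet hΦ (h i).1), fun hi =>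
      (apply_eq_of_stanleySet hΦ ((h i).2 hi)).trans ((hcb i).2 hi)⟩

/-- Pulling back a Stanley partition along a map compatible with Stanley spaces does not increase
its length. -/
theorem exists_stanleyPartition_preimage {σ : Type} [Finite σ] {Φ : (σ →₀ ℕ) → (σ →₀ ℕ)}
    (hΦ : ∀ (u : σ →₀ ℕ) (Z : Set σ) (v : σ →₀ ℕ), v ∈ stanleySet u Z ↔ Φ v ∈ stanleySet (Φ u) Z)
    {P : Set (σ →₀ ℕ)} (D : StanleyPartition P) :
    ∃ E : StanleyPartition (Φ ⁻¹' P), E.r ≤ D.r := by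
  let ι := {i : Fin D.r // (Φ ⁻¹' stanleySet (D.base i) (D.vars i)).Nonempty}
  choose c hc using fun i : ι => exists_preimage_stanleySet_eq hΦ i.2
  have cover : Φ ⁻¹' P = ⋃ i : ι, stanleySet (c i) (D.vars i.1) := by
    simp only [← hc]
    conv_lhs => rw [D.cover, Set.preimage_iUnion]
    ext w
    simp only [Set.mem_iUnion]
    exact ⟨fun ⟨i, hi⟩ => ⟨⟨i, w, hi⟩, hi⟩, fun ⟨i, hi⟩ => ⟨i.1, hi⟩⟩
  have disj : ∀ i j : ι, i ≠ j →
      Disjoint (stanleySet (c i) (D.vars i.1)) (stanleySet (c j) (D.vars j.1)) := by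
    intro i j hij
    rw [← hc, ← hc]
    exact (D.disj _ _ fun h => hij (Subtype.ext h)).preimage Φ
  obtain ⟨E, hE⟩ := exists_stanleyPartition_of_finite c (fun i => D.vars i.1) cover disj
  refine ⟨E, hE.trans_le ?_⟩
  simpa using Finite.card_subtype_le
    (fun i : Fin D.r => (Φ ⁻¹' stanleySet (D.base i) (D.vars i)).Nonempty)

/-- Comparison of Stanley lengths of `J₁/I₁` and `J₂/I₂` via a
map `Φ` on monomials compatible with membership in the ideals and with Stanley
spaces. -/
theorem stmt_8 {K : Type} [Field K] {n : ℕ}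
    (I₁ J₁ I₂ J₂ : Ideal (MvPolynomial (Fin n) K))
    (hmonI₁ : IsMonomialIdeal I₁) (hmonJ₁ : IsMonomialIdeal J₁)
    (hmonI₂ : IsMonomialIdeal I₂) (hmonJ₂ : IsMonomialIdeal J₂)
    (hI₁ : I₁ ≠ ⊥) (hIJ₁ : I₁ < J₁) (hI₂ : I₂ ≠ ⊥) (hIJ₂ : I₂ < J₂)
    (Φ : (Fin n →₀ ℕ) → (Fin n →₀ ℕ))
    (hΦI : ∀ u, u ∈ monSet I₁ ↔ Φ u ∈ monSet I₂)
    (hΦJ : ∀ u, u ∈ monSet J₁ ↔ Φ u ∈ monSet J₂)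
    (hΦS : ∀ (u : Fin n →₀ ℕ) (Z : Set (Fin n)) (v : Fin n →₀ ℕ),
      v ∈ stanleySet u Z ↔ Φ v ∈ stanleySet (Φ u) Z) :
    slength (monSet J₁ \ monSet I₁) ≤ slength (monSet J₂ \ monSet I₂) := by
  have hP : monSet J₁ \ monSet I₁ = Φ ⁻¹' (monSet J₂ \ monSet I₂) := by
    ext u
    simp [hΦI u, hΦJ u]
  obtain ⟨D₀⟩ := (isUpperSet_monSet J₂).nonempty_stanleyPartition_diff (isUpperSet_monSet I₂)
  obtain ⟨D, hD⟩ :=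
    Nat.sInf_mem (s := {r | ∃ D : StanleyPartition (monSet J₂ \ monSet I₂), D.r = r}) ⟨_, D₀, rfl⟩
  obtain ⟨E, hE⟩ := exists_stanleyPartition_preimage hΦS D
  rw [hP]
  exact (Nat.sInf_le (show E.r ∈ {r | ∃ D, StanleyPartition.r D = r} from ⟨E, rfl⟩)).trans
    (hE.trans hD.le)
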